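/- Let k₁ = 2 and t = 2 ≤ min(k₂, d). If S ⊆ [2]×[k₂] is nonempty, contains no column slice C_j, and has combinatorial type (u,v) with u + v < k₂, then I_S is not minimal among {I_{S'} : S' ⊆ [2]×[k₂]}. -/

import Mathlib

noncomputable section

open MvPolynomial

namespace CI

/-- The column index set `[k₁] × [k₂]`. -/
abbrev Col (k₁ k₂ : ℕ) := Fin k₁ × Fin k₂

/-- The polynomial ring `ℂ[X]` in the entries of the `d × (k₁k₂)` matrix `X` of
indeterminates `x_{i,(j,ℓ)}`. -/
abbrev MvP (d k₁ k₂ : ℕ) := MvPolynomial (Fin d × Col k₁ k₂) ℂ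

/-- The `r × r` minor of `X` with rows `a` and columns `b`. -/
def minorPoly (d k₁ k₂ r : ℕ) (a : Fin r → Fin d) (b : Fin r → Col k₁ k₂) :
    MvP d k₁ k₂ :=
  (Matrix.of fun i j => (X (a i, b j) : MvP d k₁ k₂)).det

/-- `F_r(X_U)`: the set of all `r × r` minors of the submatrix `X_U`. -/
def minorSet (d k₁ k₂ r : ℕ) (U : Set (Col k₁ k₂)) : Set (MvP d k₁ k₂) :=
  { f | ∃ a : Fin r → Fin d, ∃ b : Fin r → Col k₁ k₂,
      Function.Injective a ∧ Function.Injective b ∧ (∀ i, b i ∈ U) ∧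
      f = minorPoly d k₁ k₂ r a b }

/-- `I_r(X_U)`: the ideal generated by the `r × r` minors of `X_U`. -/
def minorIdeal (d k₁ k₂ r : ℕ) (U : Set (Col k₁ k₂)) : Ideal (MvP d k₁ k₂) :=
  Ideal.span (minorSet d k₁ k₂ r U)

/-- The row slice `R_i = {i} × [k₂]`. -/
def rowSlice (k₁ k₂ : ℕ) (i : Fin k₁) : Set (Col k₁ k₂) := { p | p.1 = i }

/-- The column slice `C_j = [k₁] × {j}`. -/
def colSlice (k₁ k₂ : ℕ) (j : Fin k₂) : Set (Col k₁ k₂) := { p | p.2 = j }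

/-- The conditional independence ideal `𝓘_C = Σ_j I_2(X_{C_j}) + Σ_i I_t(X_{R_i})`. -/
def ciIdeal (d k₁ k₂ t : ℕ) : Ideal (MvP d k₁ k₂) :=
  (⨆ j : Fin k₂, minorIdeal d k₁ k₂ 2 (colSlice k₁ k₂ j)) ⊔
    ⨆ i : Fin k₁, minorIdeal d k₁ k₂ t (rowSlice k₁ k₂ i)

/-- `I_∅ = I_t(X) + Σ_j I_2(X_{C_j})`. -/
def Iempty (d k₁ k₂ t : ℕ) : Ideal (MvP d k₁ k₂) :=
  minorIdeal d k₁ k₂ t Set.univ ⊔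
    ⨆ j : Fin k₂, minorIdeal d k₁ k₂ 2 (colSlice k₁ k₂ j)

/-! ### The case `k₁ = 2`: the ideals `I_S` -/

/-- The column slice `C_j` does not meet `S`. -/
def colOK (k₂ : ℕ) (S : Set (Col 2 k₂)) (j : Fin k₂) : Prop := ∀ i : Fin 2, (i, j) ∉ S

/-- `𝒞(S)`: the union of all column slices not meeting `S`. -/
def CSet (k₂ : ℕ) (S : Set (Col 2 k₂)) : Set (Col 2 k₂) := { p | colOK k₂ S p.2 }

/-- The condition `Z(1,S) ∖ Z(2,S) ≠ ∅` and `Z(2,S) ∖ Z(1,S) ≠ ∅` under which the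
`(t-1)`-minors are included in `F_S`. -/
def tCond (k₂ : ℕ) (S : Set (Col 2 k₂)) : Prop :=
  (∃ ℓ, ((0 : Fin 2), ℓ) ∈ S ∧ ((1 : Fin 2), ℓ) ∉ S) ∧
  (∃ ℓ, ((1 : Fin 2), ℓ) ∈ S ∧ ((0 : Fin 2), ℓ) ∉ S)

/-- The generating set `F_S` of the ideal `I_S` (for `k₁ = 2`). -/
def FSset (d k₂ t : ℕ) (S : Set (Col 2 k₂)) : Set (MvP d 2 k₂) :=
  minorSet d 2 k₂ 1 S ∪
  (⋃ j ∈ { j : Fin k₂ | colOK k₂ S j }, minorSet d 2 k₂ 2 (colSlice 2 k₂ j)) ∪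
  (⋃ _ : tCond k₂ S, minorSet d 2 k₂ (t - 1) (CSet k₂ S)) ∪
  minorSet d 2 k₂ t ((rowSlice 2 k₂ 0 \ S) ∪ CSet k₂ S) ∪
  minorSet d 2 k₂ t ((rowSlice 2 k₂ 1 \ S) ∪ CSet k₂ S)

/-- The ideal `I_S ⊆ ℂ[X]` for `S ⊆ [2] × [k₂]`, generated by `F_S`. -/
def ISIdeal (d k₂ t : ℕ) (S : Set (Col 2 k₂)) : Ideal (MvP d 2 k₂) :=
  Ideal.span (FSset d k₂ t S)

/-- `u = min(|R₁ ∩ S|, |R₂ ∩ S|)`, the first entry of the combinatorial type of `S`. -/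
def uOf (k₂ : ℕ) (S : Set (Col 2 k₂)) : ℕ :=
  min ((rowSlice 2 k₂ 0 ∩ S).ncard) ((rowSlice 2 k₂ 1 ∩ S).ncard)

/-- `v = max(|R₁ ∩ S|, |R₂ ∩ S|)`, the second entry of the combinatorial type of `S`. -/
def vOf (k₂ : ℕ) (S : Set (Col 2 k₂)) : ℕ :=
  max ((rowSlice 2 k₂ 0 ∩ S).ncard) ((rowSlice 2 k₂ 1 ∩ S).ncard)

/-- `S` contains no column slice. -/
def noColumn (k₂ : ℕ) (S : Set (Col 2 k₂)) : Prop :=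
  ∀ j : Fin k₂, ¬ colSlice 2 k₂ j ⊆ S

/-- A subset `S ⊆ [2] × [k₂]` is minimal: `S = ∅`, or `S` contains no column slice,
its combinatorial type `(u,v)` satisfies `1 ≤ u ≤ v ≤ k₂ - t + 1`, and `u + v = k₂`
in case `t = 2`. -/
def minimalSubset (k₂ t : ℕ) (S : Set (Col 2 k₂)) : Prop :=
  S = ∅ ∨ (noColumn k₂ S ∧ 1 ≤ uOf k₂ S ∧ uOf k₂ S ≤ vOf k₂ S ∧
    vOf k₂ S ≤ k₂ - t + 1 ∧ (t = 2 → uOf k₂ S + vOf k₂ S = k₂))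

/-! ### Hypergraphs and their closure -/

/-- The hypergraph `H(S)` on `[k₁] × [k₂]`: its hyperedges are (1) the singletons of
elements of `S`; (2) the 2-subsets of a column slice disjoint from `S`; (3) the
`(t-1)`-subsets of `{i,j} × (NZ(i,S) ∩ NZ(j,S))` for distinct rows `i, j` with
`Z(i,S) ∖ Z(j,S) ≠ ∅` and `Z(j,S) ∖ Z(i,S) ≠ ∅`; (4) the `t`-subsets of a row slice
disjoint from `S`. -/
def HS (k₁ k₂ t : ℕ) (S : Set (Col k₁ k₂)) : Set (Finset (Col k₁ k₂)) :=
  { e | (∃ p ∈ S, e = {p})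
      ∨ (e.card = 2 ∧ (∃ j, ∀ p ∈ e, p.2 = j) ∧ ∀ p ∈ e, p ∉ S)
      ∨ (e.card = t - 1 ∧ ∃ i j : Fin k₁, i ≠ j ∧
           (∃ ℓ, (i, ℓ) ∈ S ∧ (j, ℓ) ∉ S) ∧ (∃ ℓ, (j, ℓ) ∈ S ∧ (i, ℓ) ∉ S) ∧
           ∀ p ∈ e, (p.1 = i ∨ p.1 = j) ∧ (i, p.2) ∉ S ∧ (j, p.2) ∉ S)
      ∨ (e.card = t ∧ (∃ i, ∀ p ∈ e, p.1 = i) ∧ ∀ p ∈ e, p ∉ S) }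

/-- The closure of a hypergraph: iterate the rule "if `{a,b}` and `e` (with `a ∈ e`)
are hyperedges, then add `(e ∖ {a}) ∪ {b}`". -/
inductive HClosure {k₁ k₂ : ℕ} (H : Set (Finset (Col k₁ k₂))) :
    Finset (Col k₁ k₂) → Prop
  | base {e : Finset (Col k₁ k₂)} : e ∈ H → HClosure H e
  | step {e : Finset (Col k₁ k₂)} (a b : Col k₁ k₂) :
      a ∈ e → HClosure H {a, b} → HClosure H e → HClosure H (insert b (e.erase a))

/-- The determinantal ideal of a hypergraph: it is generated by the minors `[A|B]`
with `A ⊆ [d]`, `B` a hyperedge, and `|A| = |B|`. -/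
def hypIdeal (d k₁ k₂ : ℕ) (H : Set (Finset (Col k₁ k₂))) : Ideal (MvP d k₁ k₂) :=
  Ideal.span { f | ∃ e ∈ H, ∃ a : Fin e.card → Fin d, ∃ b : Fin e.card → Col k₁ k₂,
      Function.Injective a ∧ Function.Injective b ∧ (∀ i, b i ∈ e) ∧
      f = minorPoly d k₁ k₂ e.card a b }

/-- The ideal `I_S` associated to the closure of the hypergraph `H(S)`. -/
def ISclosure (d k₁ k₂ t : ℕ) (S : Set (Col k₁ k₂)) : Ideal (MvP d k₁ k₂) :=
  hypIdeal d k₁ k₂ { e | HClosure (HS k₁ k₂ t S) e }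

/-! ### The lexicographic monomial order -/

/-- `varLT a b` means the variable `x_a` is *larger* than `x_b` in the variable order
`x_{1,(1,1)} > x_{2,(1,1)} > ⋯ > x_{d,(1,1)} > x_{1,(2,1)} > ⋯ > x_{d,(k₁,k₂)}`,
i.e. `(ℓ, j, i)` precedes `(ℓ', j', i')` lexicographically, where `a = (i, (j, ℓ))`. -/
def varLT (d k₁ k₂ : ℕ) (a b : Fin d × Col k₁ k₂) : Prop :=
  Prod.Lex (· < ·) (Prod.Lex (· < ·) (· < ·))
    (a.2.2, (a.2.1, a.1)) (b.2.2, (b.2.1, b.1))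

/-- `m ≺ m'` in the lexicographic monomial order determined by the variable order:
at the largest variable where the exponents differ, `m` has the smaller exponent. -/
def monLT (d k₁ k₂ : ℕ) (m m' : (Fin d × Col k₁ k₂) →₀ ℕ) : Prop :=
  ∃ v, (∀ w, varLT d k₁ k₂ w v → m w = m' w) ∧ m v < m' v

/-- `m` is the `≺`-leading monomial of `f`. -/
def IsLeadMon (d k₁ k₂ : ℕ) (f : MvP d k₁ k₂) (m : (Fin d × Col k₁ k₂) →₀ ℕ) : Prop :=
  m ∈ f.support ∧ ∀ m' ∈ f.support, m' = m ∨ monLT d k₁ k₂ m' m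

/-- `G` is a Gröbner basis of `I` with respect to the lexicographic order `≺`:
`G` is contained in `I` and for every nonzero `f ∈ I` there is a `g ∈ G` whose
`≺`-leading monomial divides the `≺`-leading monomial of `f`. -/
def IsGB (d k₁ k₂ : ℕ) (G : Set (MvP d k₁ k₂)) (I : Ideal (MvP d k₁ k₂)) : Prop :=
  G ⊆ (I : Set (MvP d k₁ k₂)) ∧ ∀ f ∈ I, f ≠ 0 →
    ∃ g ∈ G, ∃ mg, IsLeadMon d k₁ k₂ g mg ∧
      ∀ mf, IsLeadMon d k₁ k₂ f mf → ∀ x, mg x ≤ mf x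

/-! ### The matrix `D_A` -/

/-- For `A ∈ ℂ^{k₂ × (k₁-1)}`, the `k₂ × (k₁k₂)` matrix `D_A`: its row `r` has entry
`1` in the column indexed by `(1, r)`, entry `A r ℓ` in the column indexed by
`(1+ℓ, r)` for `ℓ ∈ [k₁-1]`, and zeros elsewhere. -/
def DMat (k₁ k₂ : ℕ) (A : Matrix (Fin k₂) (Fin (k₁ - 1)) ℂ) :
    Matrix (Fin k₂) (Col k₁ k₂) ℂ := fun r c =>
  if c.2 = r then
    (if _h : (c.1 : ℕ) = 0 then 1
     else A r ⟨(c.1 : ℕ) - 1, by have := c.1.isLt; omega⟩)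
  else 0

end CI

namespace CI

/-- The vanishing of a column modulo an ideal forces the minor into that ideal. -/
theorem minorPoly_mem_of_column_mem {d k₁ k₂ r : ℕ} (I : Ideal (MvP d k₁ k₂))
    (a : Fin r → Fin d) (b : Fin r → Col k₁ k₂) (j : Fin r)
    (h : ∀ i, (X (i, b j) : MvP d k₁ k₂) ∈ I) : minorPoly d k₁ k₂ r a b ∈ I := by
  rw [← Ideal.Quotient.eq_zero_iff_mem, minorPoly, RingHom.map_det]
  exact Matrix.det_eq_zero_of_column_eq_zero j fun i =>
    Ideal.Quotient.eq_zero_iff_mem.mpr (h _)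

/-- A variable in the column `p` avoids `I_S` as soon as the matrix supported on the
column `p` lies in the zero set of the linear generators. -/
theorem X_notMem_ISIdeal {d k₂ : ℕ} {S : Set (Col 2 k₂)} {p : Col 2 k₂} (i : Fin d)
    (hp : p ∉ S) (hC : tCond k₂ S → p ∉ CSet k₂ S) :
    (X (i, p) : MvP d 2 k₂) ∉ ISIdeal d k₂ 2 S := by
  let φ : MvP d 2 k₂ →+* ℂ := eval fun q => if q.2 = p then 1 else 0
  have key : ∀ {r : ℕ} (a : Fin r → Fin d) (b : Fin r → Col 2 k₂) (j : Fin r),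
      b j ≠ p → φ (minorPoly d 2 k₂ r a b) = 0 := by
    intro r a b j hj
    refine minorPoly_mem_of_column_mem (RingHom.ker φ) a b j fun i => ?_
    simp [RingHom.mem_ker, φ, hj]
  have key₂ : ∀ U, ∀ f ∈ minorSet d 2 k₂ 2 U, φ f = 0 := by
    rintro U _ ⟨a, b, -, hb, -, rfl⟩
    by_cases h0 : b 0 = p
    · exact key a b 1 fun h1 => absurd (hb (h0.trans h1.symm)) (by decide)
    · exact key a b 0 h0
  have hle : ISIdeal d k₂ 2 S ≤ RingHom.ker φ := by
    refine Ideal.span_le.mpr ?_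
    rintro f ((((⟨a, b, -, -, hb, rfl⟩ | hf) | hf) | hf) | hf)
    · exact key a b 0 fun h => hp (h ▸ hb 0)
    · simp only [Set.mem_iUnion] at hf
      obtain ⟨j, -, hf⟩ := hf
      exact key₂ _ f hf
    · simp only [Set.mem_iUnion] at hf
      obtain ⟨ht, a, b, -, -, hb, rfl⟩ := hf
      exact key a b 0 fun h => hC ht (h ▸ hb 0)
    · exact key₂ _ f hf
    · exact key₂ _ f hf
  intro hmem
  have h := hle hmem
  simp [RingHom.mem_ker, φ] at h

theorem X_mem_minorSet_one {d k₁ k₂ : ℕ} {U : Set (Col k₁ k₂)} {p : Col k₁ k₂}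
    (hp : p ∈ U) (i : Fin d) : (X (i, p) : MvP d k₁ k₂) ∈ minorSet d k₁ k₂ 1 U :=
  ⟨fun _ => i, fun _ => p, Function.injective_of_subsingleton _,
    Function.injective_of_subsingleton _, fun _ => hp, by simp [minorPoly]⟩

theorem X_mem_ISIdeal {d k₂ t : ℕ} {S : Set (Col 2 k₂)} {p : Col 2 k₂} (hp : p ∈ S)
    (i : Fin d) : (X (i, p) : MvP d 2 k₂) ∈ ISIdeal d k₂ t S :=
  Ideal.subset_span <| Or.inl <| Or.inl <| Or.inl <| Or.inl <| X_mem_minorSet_one hp i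

theorem X_mem_ISIdeal_of_tCond {d k₂ : ℕ} {S : Set (Col 2 k₂)} {p : Col 2 k₂}
    (ht : tCond k₂ S) (hp : colOK k₂ S p.2) (i : Fin d) :
    (X (i, p) : MvP d 2 k₂) ∈ ISIdeal d k₂ 2 S :=
  Ideal.subset_span <| Or.inl <| Or.inl <| Or.inr <|
    Set.mem_iUnion.mpr ⟨ht, X_mem_minorSet_one hp i⟩

theorem minorSet_mono {d k₁ k₂ r : ℕ} {U V : Set (Col k₁ k₂)} (h : U ⊆ V) :
    minorSet d k₁ k₂ r U ⊆ minorSet d k₁ k₂ r V := by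
  rintro _ ⟨a, b, ha, hb, hU, rfl⟩
  exact ⟨a, b, ha, hb, fun i => h (hU i), rfl⟩

/-- If `S` misses one of the two row slices, then `I_S` contains all `2 × 2` minors
of `X`. -/
theorem minorSet_two_subset_ISIdeal {d k₂ : ℕ} {S : Set (Col 2 k₂)}
    (hS : (∀ ℓ, ((0 : Fin 2), ℓ) ∉ S) ∨ ∀ ℓ, ((1 : Fin 2), ℓ) ∉ S)
    (U : Set (Col 2 k₂)) :
    minorSet d 2 k₂ 2 U ⊆ (ISIdeal d k₂ 2 S : Set (MvP d 2 k₂)) := by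
  rintro _ ⟨a, b, ha, hb, -, rfl⟩
  by_cases h : ∃ j, b j ∈ S
  · obtain ⟨j, hj⟩ := h
    exact minorPoly_mem_of_column_mem _ a b j fun i => X_mem_ISIdeal hj i
  push Not at h
  refine Ideal.subset_span ?_
  rcases hS with hS | hS
  · refine Or.inl <| Or.inr ⟨a, b, ha, hb, fun j => ?_, rfl⟩
    have hj := h j
    rcases hbj : b j with ⟨i, ℓ⟩
    rw [hbj] at hj
    fin_cases i
    · exact Or.inl ⟨rfl, hj⟩
    · exact Or.inr fun i => by fin_cases i; exacts [hS ℓ, hj]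
  · refine Or.inr ⟨a, b, ha, hb, fun j => ?_, rfl⟩
    have hj := h j
    rcases hbj : b j with ⟨i, ℓ⟩
    rw [hbj] at hj
    fin_cases i
    · exact Or.inr fun i => by fin_cases i; exacts [hj, hS ℓ]
    · exact Or.inl ⟨rfl, hj⟩

theorem ISIdeal_empty_le {d k₂ : ℕ} {S : Set (Col 2 k₂)}
    (hS : (∀ ℓ, ((0 : Fin 2), ℓ) ∉ S) ∨ ∀ ℓ, ((1 : Fin 2), ℓ) ∉ S) :
    ISIdeal d k₂ 2 ∅ ≤ ISIdeal d k₂ 2 S := by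
  refine Ideal.span_le.mpr ?_
  rintro f ((((⟨a, b, -, -, hb, rfl⟩ | hf) | hf) | hf) | hf)
  · exact absurd (hb 0) (Set.notMem_empty _)
  · simp only [Set.mem_iUnion] at hf
    obtain ⟨j, -, hf⟩ := hf
    exact minorSet_two_subset_ISIdeal hS _ hf
  · simp only [Set.mem_iUnion] at hf
    obtain ⟨⟨⟨ℓ, hℓ, -⟩, -⟩, -⟩ := hf
    exact absurd hℓ (Set.notMem_empty _)
  · exact minorSet_two_subset_ISIdeal hS _ hf
  · exact minorSet_two_subset_ISIdeal hS _ hf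

/-- Adding to `S` the first-row part of `𝒞(S)` leaves no column slice disjoint from it. -/
theorem not_colOK_union (k₂ : ℕ) (S : Set (Col 2 k₂)) (j : Fin k₂) :
    ¬ colOK k₂ (S ∪ rowSlice 2 k₂ 0 ∩ CSet k₂ S) j := fun h =>
  h 0 (Or.inr ⟨rfl, fun i hi => h i (Or.inl hi)⟩)

theorem ISIdeal_union_le {d k₂ : ℕ} {S : Set (Col 2 k₂)} (ht : tCond k₂ S) :
    ISIdeal d k₂ 2 (S ∪ rowSlice 2 k₂ 0 ∩ CSet k₂ S) ≤ ISIdeal d k₂ 2 S := by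
  have hsub : ∀ i, (rowSlice 2 k₂ i \ (S ∪ rowSlice 2 k₂ 0 ∩ CSet k₂ S)) ∪
      CSet k₂ (S ∪ rowSlice 2 k₂ 0 ∩ CSet k₂ S) ⊆ (rowSlice 2 k₂ i \ S) ∪ CSet k₂ S := by
    rintro i p (⟨hp, hpS⟩ | hp)
    · exact Or.inl ⟨hp, fun h => hpS (Or.inl h)⟩
    · exact absurd hp (not_colOK_union k₂ S _)
  refine Ideal.span_le.mpr ?_
  rintro f ((((⟨a, b, -, -, hb, rfl⟩ | hf) | hf) | hf) | hf)
  · refine minorPoly_mem_of_column_mem _ a b 0 fun i => ?_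
    rcases hb 0 with h | h
    · exact X_mem_ISIdeal h i
    · exact X_mem_ISIdeal_of_tCond ht h.2 i
  · simp only [Set.mem_iUnion] at hf
    obtain ⟨j, hj, -⟩ := hf
    exact absurd hj (not_colOK_union k₂ S j)
  · simp only [Set.mem_iUnion] at hf
    obtain ⟨-, a, b, -, -, hb, -⟩ := hf
    exact absurd (hb 0) (not_colOK_union k₂ S _)
  · exact Ideal.subset_span <| Or.inl <| Or.inr <| minorSet_mono (hsub 0) hf
  · exact Ideal.subset_span <| Or.inr <| minorSet_mono (hsub 1) hf

theorem exists_colOK {k₂ : ℕ} {S : Set (Col 2 k₂)} (h : uOf k₂ S + vOf k₂ S < k₂) :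
    ∃ j, colOK k₂ S j := by
  by_contra! hno
  rw [uOf, vOf, min_add_max] at h
  have hcover : (Set.univ : Set (Fin k₂)) ⊆
      Prod.snd '' ((rowSlice 2 k₂ 0 ∩ S) ∪ (rowSlice 2 k₂ 1 ∩ S)) := by
    intro j _
    have hj := hno j
    simp only [colOK, not_forall, not_not] at hj
    obtain ⟨i, hi⟩ := hj
    refine ⟨(i, j), ?_, rfl⟩
    fin_cases i
    · exact Or.inl ⟨rfl, hi⟩
    · exact Or.inr ⟨rfl, hi⟩
  have h₁ := Set.ncard_le_ncard hcover (Set.toFinite _)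
  have h₂ := Set.ncard_image_le (f := Prod.snd)
    (Set.toFinite ((rowSlice 2 k₂ 0 ∩ S) ∪ (rowSlice 2 k₂ 1 ∩ S)))
  have h₃ := Set.ncard_union_le (rowSlice 2 k₂ 0 ∩ S) (rowSlice 2 k₂ 1 ∩ S)
  rw [Set.ncard_univ, Nat.card_eq_fintype_card, Fintype.card_fin] at h₁
  omega

/-- If `S` contains no column slice and meets both row slices, then the
`(t-1)`-minors occur among the generators. -/
theorem tCond_of_noColumn {k₂ : ℕ} {S : Set (Col 2 k₂)} (hcol : noColumn k₂ S)
    (h₀ : ∃ ℓ, ((0 : Fin 2), ℓ) ∈ S) (h₁ : ∃ ℓ, ((1 : Fin 2), ℓ) ∈ S) : tCond k₂ S := by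
  have key : ∀ ℓ, ((0 : Fin 2), ℓ) ∈ S → ((1 : Fin 2), ℓ) ∉ S := by
    rintro ℓ h0 h1
    refine hcol ℓ ?_
    rintro ⟨i, _⟩ rfl
    fin_cases i
    exacts [h0, h1]
  obtain ⟨ℓ, hℓ⟩ := h₀
  obtain ⟨m, hm⟩ := h₁
  exact ⟨⟨ℓ, hℓ, key ℓ hℓ⟩, m, hm, fun h => key m h hm⟩

/-- for `t = 2 ≤ min(k₂, d)`, if `S` is nonempty, contains no column
slice, and has combinatorial type `(u,v)` with `u + v < k₂`, then `I_S` is not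
minimal among `{I_{S'} : S' ⊆ [2]×[k₂]}`. -/
theorem not_minimal_of_t_eq_two_sum_lt
    (d k₂ : ℕ) (hk : 2 ≤ k₂) (hd : 2 ≤ d)
    (S : Set (Col 2 k₂)) (hne : S ≠ ∅) (hcol : noColumn k₂ S)
    (hsum : uOf k₂ S + vOf k₂ S < k₂) :
    ∃ S' : Set (Col 2 k₂), ISIdeal d k₂ 2 S' < ISIdeal d k₂ 2 S := by
  let i : Fin d := ⟨0, by omega⟩
  by_cases hrows : (∃ ℓ, ((0 : Fin 2), ℓ) ∈ S) ∧ ∃ ℓ, ((1 : Fin 2), ℓ) ∈ S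
  · have ht := tCond_of_noColumn hcol hrows.1 hrows.2
    obtain ⟨j, hj⟩ := exists_colOK hsum
    refine ⟨_, SetLike.lt_iff_le_and_exists.mpr ⟨ISIdeal_union_le ht, X (i, (1, j)),
      X_mem_ISIdeal_of_tCond ht hj i, X_notMem_ISIdeal i ?_ fun _ => not_colOK_union k₂ S j⟩⟩
    rintro (h | ⟨h, -⟩)
    · exact hj 1 h
    · exact absurd h (by simp [rowSlice])
  · obtain ⟨p, hp⟩ := Set.nonempty_iff_ne_empty.mpr hne
    rw [not_and_or, not_exists, not_exists] at hrows
    refine ⟨∅, SetLike.lt_iff_le_and_exists.mpr ⟨ISIdeal_empty_le hrows, X (i, p),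
      X_mem_ISIdeal hp i, X_notMem_ISIdeal i (Set.notMem_empty p) ?_⟩⟩
    rintro ⟨⟨ℓ, hℓ, -⟩, -⟩
    exact absurd hℓ (Set.notMem_empty _)

end CI
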